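/- Let d be a real number with 0 ≤ d < 1/2. Then the fourth cumulant of the Rosenblatt distribution, κ₄(d) = 48·((1/2)(1−2d)(1−d))²·c₄(d) where c₄(d) is the integral over [0,1]⁴ of |x₁−x₂|^(−d)|x₂−x₃|^(−d)|x₃−x₄|^(−d)|x₄−x₁|^(−d), satisfies κ₄(d) = (12(1−2d)²/((1−d)(3−4d))) · ( 2·Γ(1−d)Γ(2−d)²/Γ(3−3d) + Γ(1−d)²Γ(2−d)²/Γ(2−2d)² + ₃F₂(1, d, 2−2d; 2−d, 3−2d; 1) ). -/

import Mathlib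

open Real
noncomputable def poch (a : ℝ) (k : ℕ) : ℝ := ∏ i ∈ Finset.range k, (a + i)

noncomputable def F21 (a b c x : ℝ) : ℝ :=
  ∑' k : ℕ, poch a k * poch b k / (poch c k * (Nat.factorial k : ℝ)) * x ^ k

noncomputable def F32 (a b c e f : ℝ) : ℝ :=
  ∑' k : ℕ, poch a k * poch b k * poch c k / (poch e k * poch f k * (Nat.factorial k : ℝ))

noncomputable def F32x (a b c e f x : ℝ) : ℝ :=
  ∑' k : ℕ, poch a k * poch b k * poch c k / (poch e k * poch f k * (Nat.factorial k : ℝ)) * x ^ k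

noncomputable def F43 (a b c g e f h : ℝ) : ℝ :=
  ∑' k : ℕ, poch a k * poch b k * poch c k * poch g k /
    (poch e k * poch f k * poch h k * (Nat.factorial k : ℝ))

noncomputable def c4 (d : ℝ) : ℝ :=
  ∫ x1 in (0:ℝ)..1, ∫ x2 in (0:ℝ)..1, ∫ x3 in (0:ℝ)..1, ∫ x4 in (0:ℝ)..1,
    |x1 - x2| ^ (-d) * |x2 - x3| ^ (-d) * |x3 - x4| ^ (-d) * |x4 - x1| ^ (-d)


open MeasureTheory in
noncomputable def muI : Measure ℝ := volume.restrict (Set.Ioo (0:ℝ) 1)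

section helpers
open MeasureTheory Set
open scoped ENNReal

instance muI_prob : IsProbabilityMeasure muI := ⟨by simp [muI]⟩

lemma muI_ae : ∀ᵐ t ∂muI, t ∈ Ioo (0:ℝ) 1 := ae_restrict_mem measurableSet_Ioo

noncomputable abbrev piI (n : ℕ) : Measure (Fin n → ℝ) := Measure.pi (fun _ => muI)

lemma piI_eq (n : ℕ) : piI n = volume.restrict (Set.pi univ (fun _ : Fin n => Ioo (0:ℝ) 1)) := by
  rw [volume_pi, Measure.restrict_pi_pi]; rfl

lemma meas_insertNth {n : ℕ} (i : Fin (n+1)) (t : ℝ) :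
    Measurable fun z : Fin n → ℝ => (i.insertNth t z : Fin (n+1) → ℝ) := by
  have h := (measurePreserving_piFinSuccAbove (fun _ : Fin (n+1) => muI) i).symm.measurable
  exact h.comp (measurable_const.prodMk measurable_id)

lemma piI_split {n : ℕ} (f : (Fin (n+1) → ℝ) → ℝ≥0∞) (hf : Measurable f) (i : Fin (n+1)) :
    ∫⁻ x, f x ∂piI (n+1) = ∫⁻ t, ∫⁻ z, f (i.insertNth t z) ∂piI n ∂muI := by
  have h := (measurePreserving_piFinSuccAbove (fun _ : Fin (n+1) => muI) i).symm
  rw [← h.lintegral_comp hf, lintegral_prod (fun z => f ((MeasurableEquiv.piFinSuccAbove (fun _ => ℝ) i).symm z))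
    (hf.comp h.measurable).aemeasurable]
  rfl

lemma scale_lint {n : ℕ} (G : (Fin n → ℝ) → ℝ≥0∞) (hG : Measurable G) (t : ℝ) (ht : 0 < t) :
    ∫⁻ z, G z = ENNReal.ofReal (t^n) * ∫⁻ z, G (t • z) := by
  have h := Measure.map_addHaar_smul (volume : Measure (Fin n → ℝ)) ht.ne'
  have h2 : ∫⁻ z, G (t • z) = ∫⁻ z, G z ∂(Measure.map (t • ·) volume) := by
    rw [lintegral_map hG (by fun_prop)]
  rw [h2, h, lintegral_smul_measure, smul_eq_mul, ← mul_assoc, ← ENNReal.ofReal_mul (by positivity)]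
  have : t ^ n ≠ 0 := by positivity
  rw [abs_of_nonneg (by positivity)]
  simp [this]

lemma piI_offdiag {n : ℕ} : ∀ᵐ x ∂piI n, ∀ i j : Fin n, i ≠ j → x i ≠ x j := by
  rw [piI_eq]
  apply ae_restrict_of_ae
  rw [ae_all_iff]; intro i
  rw [ae_all_iff]; intro j
  by_cases hij : i = j
  · simp [hij]
  let S : Submodule ℝ (Fin n → ℝ) := LinearMap.ker ((LinearMap.proj i : (Fin n → ℝ) →ₗ[ℝ] ℝ) - (LinearMap.proj j : (Fin n → ℝ) →ₗ[ℝ] ℝ))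
  have hS : S ≠ ⊤ := by
    intro h
    have : (Pi.single i 1 : Fin n → ℝ) ∈ S := by rw [h]; trivial
    simp [S, LinearMap.mem_ker, Ne.symm hij] at this
  have h0 := Measure.addHaar_submodule (volume : Measure (Fin n → ℝ)) S hS
  refine measure_mono_null ?_ h0
  intro x hx
  simp only [mem_compl_iff, mem_ofPred_eq, not_forall, not_not] at hx
  obtain ⟨_, hx⟩ := hx
  simp [S, LinearMap.mem_ker, hx]

lemma max_split {n : ℕ} (f : (Fin (n+1) → ℝ) → ℝ≥0∞) (hf : Measurable f) :
    ∫⁻ x, f x ∂piI (n+1) = ∑ i : Fin (n+1), ∫⁻ t, ENNReal.ofReal (t^n) *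
      ∫⁻ z, f (i.insertNth t (t • z)) ∂piI n ∂muI := by
  let A : Fin (n+1) → Set (Fin (n+1) → ℝ) := fun i => {x | ∀ j, j ≠ i → x j < x i}
  have hA : ∀ i, MeasurableSet (A i) := by
    intro i
    have : A i = ⋂ j, ⋂ (_ : j ≠ i), {x | x j < x i} := by ext x; simp [A]
    rw [this]
    exact MeasurableSet.iInter fun j => MeasurableSet.iInter fun _ =>
      measurableSet_lt (measurable_pi_apply j) (measurable_pi_apply i)
  have h1 : ∫⁻ x, f x ∂piI (n+1) = ∫⁻ x, ∑ i, (A i).indicator f x ∂piI (n+1) := by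
    apply lintegral_congr_ae
    filter_upwards [piI_offdiag] with x hx
    obtain ⟨i, -, hi⟩ := Finset.exists_max_image (Finset.univ : Finset (Fin (n+1))) x ⟨0, Finset.mem_univ _⟩
    have hiA : x ∈ A i := fun j hj => lt_of_le_of_ne (hi j (Finset.mem_univ _)) (hx j i hj)
    rw [Finset.sum_eq_single i]
    · rw [indicator_of_mem hiA]
    · intro j _ hj
      apply indicator_of_notMem
      intro hjA
      exact absurd (hjA i (Ne.symm hj)) (not_lt.2 (hi j (Finset.mem_univ _)))
    · simp
  rw [h1, lintegral_finsetSum _ (fun i _ => hf.indicator (hA i))]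
  refine Finset.sum_congr rfl fun i _ => ?_
  rw [piI_split _ (hf.indicator (hA i)) i]
  apply lintegral_congr_ae
  filter_upwards [muI_ae] with t ht
  have hm : Measurable fun z : Fin n → ℝ => f (i.insertNth t z) := by
    apply hf.comp
    exact meas_insertNth i t
  rw [piI_eq, ← lintegral_indicator (MeasurableSet.univ_pi fun _ => measurableSet_Ioo),
    ← lintegral_indicator (MeasurableSet.univ_pi fun _ => measurableSet_Ioo)]
  have h2 : ∀ z : Fin n → ℝ, (Set.pi univ (fun _ : Fin n => Ioo (0:ℝ) 1)).indicator
      (fun z => (A i).indicator f (i.insertNth t z)) z =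
      (Set.pi univ (fun _ : Fin n => Ioo (0:ℝ) t)).indicator (fun z => f (i.insertNth t z)) z := by
    intro z
    have hk : (i.insertNth t z : Fin (n+1) → ℝ) ∈ A i ↔ ∀ j, z j < t := by
      simp [A, Fin.forall_iff_succAbove i]
    by_cases hz : ∀ j, 0 < z j ∧ z j < t
    · rw [indicator_of_mem, indicator_of_mem, indicator_of_mem]
      · simpa [mem_pi] using hz
      · exact hk.2 fun j => (hz j).2
      · simp only [mem_pi, mem_univ, forall_const, mem_Ioo]
        exact fun j => ⟨(hz j).1, (hz j).2.trans ht.2⟩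
    · rw [indicator_of_notMem (s := Set.pi univ (fun _ : Fin n => Ioo (0:ℝ) t))]
      swap
      · simpa [mem_pi] using hz
      by_cases h3 : z ∈ Set.pi univ (fun _ : Fin n => Ioo (0:ℝ) 1)
      · rw [indicator_of_mem h3, indicator_of_notMem]
        rw [hk]; intro h4
        apply hz; intro j
        exact ⟨(h3 j trivial).1, h4 j⟩
      · rw [indicator_of_notMem h3]
  simp_rw [h2]
  rw [scale_lint _ (hm.indicator (MeasurableSet.univ_pi fun _ => measurableSet_Ioo)) t ht.1]
  congr 1
  apply lintegral_congr
  intro z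
  have h5 : t • z ∈ Set.pi univ (fun _ : Fin n => Ioo (0:ℝ) t) ↔ z ∈ Set.pi univ (fun _ : Fin n => Ioo (0:ℝ) 1) := by
    simp only [mem_pi, mem_univ, forall_const, mem_Ioo, Pi.smul_apply, smul_eq_mul]
    refine forall_congr' fun j => ?_
    rw [mul_pos_iff_of_pos_left ht.1, mul_lt_iff_lt_one_right ht.1]
  by_cases h6 : z ∈ Set.pi univ (fun _ : Fin n => Ioo (0:ℝ) 1)
  · rw [indicator_of_mem h6, indicator_of_mem (h5.2 h6)]
  · rw [indicator_of_notMem h6, indicator_of_notMem (fun h => h6 (h5.1 h))]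

lemma piI_perm {n : ℕ} (f : (Fin n → ℝ) → ℝ≥0∞) (hf : Measurable f) (e : Equiv.Perm (Fin n)) :
    ∫⁻ x, f (fun j => x (e j)) ∂piI n = ∫⁻ x, f x ∂piI n := by
  have h := (measurePreserving_piCongrLeft (fun _ : Fin n => muI) e).symm
  rw [← h.lintegral_comp hf]
  rfl

lemma muI_refl : MeasurePreserving (fun t : ℝ => 1 - t) muI muI := by
  have h := (Measure.measurePreserving_sub_left (volume : Measure ℝ) 1)
  have h2 := h.restrict_preimage (s := Ioo (0:ℝ) 1) measurableSet_Ioo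
  have : (fun t : ℝ => 1 - t) ⁻¹' Ioo 0 1 = Ioo 0 1 := by
    ext t; simp only [mem_preimage, mem_Ioo]; constructor <;> rintro ⟨a, b⟩ <;> constructor <;> linarith
  rw [this] at h2
  exact h2

lemma piI_refl {n : ℕ} (f : (Fin n → ℝ) → ℝ≥0∞) (hf : Measurable f) :
    ∫⁻ x, f (fun j => 1 - x j) ∂piI n = ∫⁻ x, f x ∂piI n :=
  (measurePreserving_pi (fun _ : Fin n => muI) (fun _ => muI) (fun _ => muI_refl)).lintegral_comp hf

lemma piI_zero (f : (Fin 0 → ℝ) → ℝ≥0∞) : ∫⁻ x, f x ∂piI 0 = f ![] := by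
  rw [piI, Measure.pi_of_empty _ ![]]
  simp

lemma piI_one (f : (Fin 1 → ℝ) → ℝ≥0∞) (hf : Measurable f) :
    ∫⁻ x, f x ∂piI 1 = ∫⁻ t, f ![t] ∂muI := by
  rw [piI_split f hf 0]
  simp_rw [piI_zero, Fin.insertNth_zero']
  rfl

lemma piI_two (f : (Fin 2 → ℝ) → ℝ≥0∞) (hf : Measurable f) :
    ∫⁻ x, f x ∂piI 2 = ∫⁻ t, ∫⁻ s, f ![t, s] ∂muI ∂muI := by
  rw [piI_split f hf 0]
  refine lintegral_congr fun t => ?_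
  rw [piI_one (fun z => f ((0 : Fin 2).insertNth t z))]
  · simp_rw [Fin.insertNth_zero']
    rfl
  · exact hf.comp (meas_insertNth _ _)

lemma piI_four (f : (Fin 4 → ℝ) → ℝ≥0∞) (hf : Measurable f) :
    ∫⁻ x, f x ∂piI 4 = ∫⁻ a, ∫⁻ b, ∫⁻ t, ∫⁻ s, f ![a, b, t, s] ∂muI ∂muI ∂muI ∂muI := by
  rw [piI_split f hf 0]
  refine lintegral_congr fun t => ?_
  have h1 : Measurable (fun z : Fin 3 → ℝ => f ((0 : Fin 4).insertNth t z)) :=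
    hf.comp (meas_insertNth _ _)
  rw [piI_split _ h1 0]
  refine lintegral_congr fun s => ?_
  rw [piI_two]
  · simp_rw [Fin.insertNth_zero']
    rfl
  · exact h1.comp (meas_insertNth _ _)

lemma nest_step {h : ℝ → ℝ} {H : ℝ → ℝ≥0∞} (hH : Measurable H) (hfin : ∫⁻ t, H t ∂muI < ∞)
    (hh : ∀ t, H t < ∞ → h t = (H t).toReal) :
    ∫ t in (0:ℝ)..1, h t = (∫⁻ t, H t ∂muI).toReal := by
  have hae := ae_lt_top hH hfin.ne
  rw [← integral_toReal hH.aemeasurable hae, intervalIntegral.integral_of_le zero_le_one,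
    integral_Ioc_eq_integral_Ioo]
  refine integral_congr_ae ?_
  filter_upwards [hae] with t ht using hh t ht

end helpers

section helpers2
open MeasureTheory Set
open scoped ENNReal

noncomputable def kd (d x : ℝ) : ℝ≥0∞ := ENNReal.ofReal (|x| ^ (-d))

@[fun_prop]
lemma kd_meas (d : ℝ) : Measurable (kd d) := by unfold kd; fun_prop

lemma kd_mul (d t x : ℝ) (ht : 0 < t) : kd d (t * x) = ENNReal.ofReal (t ^ (-d)) * kd d x := by
  unfold kd
  rw [abs_mul, abs_of_pos ht, Real.mul_rpow ht.le (abs_nonneg _), ENNReal.ofReal_mul (by positivity)]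

lemma kd_neg (d x : ℝ) : kd d (-x) = kd d x := by simp [kd]

lemma kd_comm (d x y : ℝ) : kd d (x - y) = kd d (y - x) := by rw [← kd_neg, neg_sub]

lemma beta_lint {a b : ℝ} (ha : 0 < a) (hb : 0 < b) :
    ∫⁻ x, ENNReal.ofReal (x ^ (a-1) * (1-x) ^ (b-1)) ∂muI
      = ENNReal.ofReal (ProbabilityTheory.beta a b) := by
  have h := ProbabilityTheory.lintegral_betaPDF_eq_one ha hb
  have hB := ProbabilityTheory.beta_pos ha hb
  rw [ProbabilityTheory.lintegral_betaPDF] at h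
  simp_rw [mul_assoc] at h
  have h2 : ∀ x : ℝ, ENNReal.ofReal (1 / ProbabilityTheory.beta a b * (x ^ (a-1) * (1-x) ^ (b-1)))
      = ENNReal.ofReal (1 / ProbabilityTheory.beta a b) * ENNReal.ofReal (x ^ (a-1) * (1-x) ^ (b-1)) :=
    fun x => ENNReal.ofReal_mul (by positivity)
  simp_rw [h2] at h
  rw [lintegral_const_mul _ (by fun_prop)] at h
  calc _ = ENNReal.ofReal (ProbabilityTheory.beta a b) * (ENNReal.ofReal (1 / ProbabilityTheory.beta a b) *
        ∫⁻ x, ENNReal.ofReal (x ^ (a-1) * (1-x) ^ (b-1)) ∂muI) := by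
        rw [← mul_assoc, ← ENNReal.ofReal_mul hB.le]
        simp [hB.ne']
    _ = _ := by
        unfold muI; rw [h, mul_one]

lemma pow_lint {p : ℝ} (hp : -1 < p) :
    ∫⁻ x, ENNReal.ofReal (x ^ p) ∂muI = ENNReal.ofReal (1 / (p+1)) := by
  have h := beta_lint (a := p+1) (b := 1) (by linarith) one_pos
  simp only [add_sub_cancel_right, sub_self, Real.rpow_zero, mul_one] at h
  rw [h]
  congr 1
  have : Real.Gamma (p+1) ≠ 0 := (Real.Gamma_pos_of_pos (by linarith)).ne'
  have h3 : p + 1 ≠ 0 := by linarith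
  rw [ProbabilityTheory.beta, Real.Gamma_one, Real.Gamma_add_one h3]
  field_simp

lemma homog {n : ℕ} (f : (Fin (n+1) → ℝ) → ℝ≥0∞) (hf : Measurable f) (c : ℝ) (hc : c < n + 1)
    (hh : ∀ t : ℝ, 0 < t → ∀ x, f (t • x) = ENNReal.ofReal (t ^ (-c)) * f x) :
    ∫⁻ x, f x ∂piI (n+1) = ENNReal.ofReal (1 / (n + 1 - c)) *
      ∑ i : Fin (n+1), ∫⁻ z, f (i.insertNth 1 z) ∂piI n := by
  rw [max_split f hf, Finset.mul_sum]
  refine Finset.sum_congr rfl fun i _ => ?_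
  have h1 : ∫⁻ t, ENNReal.ofReal (t^n) * ∫⁻ z, f (i.insertNth t (t • z)) ∂piI n ∂muI
      = ∫⁻ t, ENNReal.ofReal (t ^ ((n:ℝ) - c)) * ∫⁻ z, f (i.insertNth 1 z) ∂piI n ∂muI := by
    apply lintegral_congr_ae
    filter_upwards [muI_ae] with t ht
    have h2 : ∀ z : Fin n → ℝ, f (i.insertNth t (t • z)) = ENNReal.ofReal (t ^ (-c)) * f (i.insertNth 1 z) := by
      intro z
      rw [← hh t ht.1]
      congr 1
      ext j
      refine Fin.succAboveCases i ?_ (fun j => ?_) j <;> simp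
    simp_rw [h2]
    rw [lintegral_const_mul _ (show Measurable fun z : Fin n → ℝ => f (i.insertNth 1 z) from
        hf.comp (meas_insertNth _ _)), ← mul_assoc,
      ← ENNReal.ofReal_mul (by have := ht.1; positivity), ← Real.rpow_natCast, ← Real.rpow_add ht.1]
    rfl
  rw [h1, lintegral_mul_const _ (by fun_prop), pow_lint (by linarith)]
  congr 3
  ring

noncomputable def J1 (d : ℝ) : ℝ≥0∞ := ∫⁻ w, kd d (w 0) * kd d (w 0 - w 1) * kd d (w 1 - 1) ∂piI 2
noncomputable def J2 (d : ℝ) : ℝ≥0∞ :=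
  ∫⁻ w, kd d (w 0) * kd d (w 0 - 1) * kd d (1 - w 1) * kd d (w 1) ∂piI 2
noncomputable def M3 (d : ℝ) : ℝ≥0∞ :=
  ∫⁻ z, kd d (z 0) * kd d (z 0 - z 1) * kd d (z 1 - z 2) * kd d (z 2) ∂piI 3
noncomputable def I4 (d : ℝ) : ℝ≥0∞ :=
  ∫⁻ x, kd d (x 0 - x 1) * kd d (x 1 - x 2) * kd d (x 2 - x 3) * kd d (x 3 - x 0) ∂piI 4

lemma kd_one (d : ℝ) : kd d 1 = 1 := by simp [kd]

lemma rpow4 (d t : ℝ) (ht : 0 < t) : ENNReal.ofReal (t ^ (-(4*d))) = ENNReal.ofReal (t ^ (-d)) *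
    ENNReal.ofReal (t ^ (-d)) * ENNReal.ofReal (t ^ (-d)) * ENNReal.ofReal (t ^ (-d)) := by
  rw [← ENNReal.ofReal_mul (by positivity), ← ENNReal.ofReal_mul (by positivity),
    ← ENNReal.ofReal_mul (by positivity), ← Real.rpow_add ht, ← Real.rpow_add ht, ← Real.rpow_add ht]
  congr 2; ring

lemma M3_eq (d : ℝ) (h1 : d < 1/2) :
    M3 d = ENNReal.ofReal (1 / (3 - 4*d)) * (2 * J1 d + J2 d) := by
  unfold M3
  rw [homog (n := 2) _ (by fun_prop) (4*d) (by push_cast; linarith)]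
  · rw [Fin.sum_univ_three]
    have e0 : ∫⁻ z, (fun z : Fin 3 → ℝ => kd d (z 0) * kd d (z 0 - z 1) * kd d (z 1 - z 2) * kd d (z 2))
        ((0 : Fin 3).insertNth 1 z) ∂piI 2 = J1 d := by
      unfold J1
      rw [← piI_perm (fun w : Fin 2 → ℝ => kd d (w 0) * kd d (w 0 - w 1) * kd d (w 1 - 1)) (by fun_prop)
        (Equiv.swap 0 1)]
      refine lintegral_congr fun z => ?_
      have a0 : ((0 : Fin 3).insertNth 1 z : Fin 3 → ℝ) 0 = 1 := rfl
      have a1 : ((0 : Fin 3).insertNth 1 z : Fin 3 → ℝ) 1 = z 0 := rfl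
      have a2 : ((0 : Fin 3).insertNth 1 z : Fin 3 → ℝ) 2 = z 1 := rfl
      simp only [a0, a1, a2, kd_one, Equiv.swap_apply_left, Equiv.swap_apply_right]
      rw [kd_comm d (z 1) (z 0), kd_comm d 1 (z 0)]
      ring
    have e1 : ∫⁻ z, (fun z : Fin 3 → ℝ => kd d (z 0) * kd d (z 0 - z 1) * kd d (z 1 - z 2) * kd d (z 2))
        ((1 : Fin 3).insertNth 1 z) ∂piI 2 = J2 d := by
      unfold J2
      refine lintegral_congr fun z => ?_
      have a0 : ((1 : Fin 3).insertNth 1 z : Fin 3 → ℝ) 0 = z 0 := rfl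
      have a1 : ((1 : Fin 3).insertNth 1 z : Fin 3 → ℝ) 1 = 1 := rfl
      have a2 : ((1 : Fin 3).insertNth 1 z : Fin 3 → ℝ) 2 = z 1 := rfl
      simp only [a0, a1, a2]
    have e2 : ∫⁻ z, (fun z : Fin 3 → ℝ => kd d (z 0) * kd d (z 0 - z 1) * kd d (z 1 - z 2) * kd d (z 2))
        ((2 : Fin 3).insertNth 1 z) ∂piI 2 = J1 d := by
      unfold J1
      refine lintegral_congr fun z => ?_
      have a0 : ((2 : Fin 3).insertNth 1 z : Fin 3 → ℝ) 0 = z 0 := rfl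
      have a1 : ((2 : Fin 3).insertNth 1 z : Fin 3 → ℝ) 1 = z 1 := rfl
      have a2 : ((2 : Fin 3).insertNth 1 z : Fin 3 → ℝ) 2 = 1 := rfl
      simp only [a0, a1, a2, kd_one, mul_one]
    rw [e0, e1, e2]
    congr 1
    · congr 2; push_cast; ring
    · ring
  · intro t ht x
    simp only [Pi.smul_apply, smul_eq_mul, ← mul_sub, kd_mul d t _ ht, rpow4 d t ht]
    ring

lemma I4_eq (d : ℝ) (h1 : d < 1/2) :
    I4 d = ENNReal.ofReal (1 / (4 - 4*d)) * (4 * M3 d) := by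
  unfold I4
  rw [homog (n := 3) _ (by fun_prop) (4*d) (by push_cast; linarith)]
  · rw [Fin.sum_univ_four]
    let g : (Fin 3 → ℝ) → ℝ≥0∞ := fun z => kd d (z 0 - 1) * kd d (z 0 - z 1) * kd d (z 1 - z 2) * kd d (z 2 - 1)
    have hgm : Measurable g := by fun_prop
    have hg : M3 d = ∫⁻ z, g z ∂piI 3 := by
      rw [← piI_refl g hgm]
      unfold M3
      refine lintegral_congr fun z => ?_
      simp only [g, sub_sub_cancel_left, kd_neg, sub_sub_sub_cancel_left]
      rw [kd_comm d (z 1) (z 0), kd_comm d (z 2) (z 1)]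
    have e0 : ∫⁻ z, (fun x : Fin 4 → ℝ => kd d (x 0 - x 1) * kd d (x 1 - x 2) * kd d (x 2 - x 3) * kd d (x 3 - x 0))
        ((0 : Fin 4).insertNth 1 z) ∂piI 3 = M3 d := by
      rw [hg]
      refine lintegral_congr fun z => ?_
      have a0 : ((0 : Fin 4).insertNth 1 z : Fin 4 → ℝ) 0 = 1 := rfl
      have a1 : ((0 : Fin 4).insertNth 1 z : Fin 4 → ℝ) 1 = z 0 := rfl
      have a2 : ((0 : Fin 4).insertNth 1 z : Fin 4 → ℝ) 2 = z 1 := rfl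
      have a3 : ((0 : Fin 4).insertNth 1 z : Fin 4 → ℝ) 3 = z 2 := rfl
      simp only [g, a0, a1, a2, a3]
      rw [kd_comm d 1 (z 0)]
    have e3 : ∫⁻ z, (fun x : Fin 4 → ℝ => kd d (x 0 - x 1) * kd d (x 1 - x 2) * kd d (x 2 - x 3) * kd d (x 3 - x 0))
        ((3 : Fin 4).insertNth 1 z) ∂piI 3 = M3 d := by
      rw [hg]
      refine lintegral_congr fun z => ?_
      have a0 : ((3 : Fin 4).insertNth 1 z : Fin 4 → ℝ) 0 = z 0 := rfl
      have a1 : ((3 : Fin 4).insertNth 1 z : Fin 4 → ℝ) 1 = z 1 := rfl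
      have a2 : ((3 : Fin 4).insertNth 1 z : Fin 4 → ℝ) 2 = z 2 := rfl
      have a3 : ((3 : Fin 4).insertNth 1 z : Fin 4 → ℝ) 3 = 1 := rfl
      simp only [g, a0, a1, a2, a3]
      rw [kd_comm d 1 (z 0)]
      ring
    have e1 : ∫⁻ z, (fun x : Fin 4 → ℝ => kd d (x 0 - x 1) * kd d (x 1 - x 2) * kd d (x 2 - x 3) * kd d (x 3 - x 0))
        ((1 : Fin 4).insertNth 1 z) ∂piI 3 = M3 d := by
      rw [hg, ← piI_perm g hgm (finRotate 3)]
      refine lintegral_congr fun z => ?_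
      have a0 : ((1 : Fin 4).insertNth 1 z : Fin 4 → ℝ) 0 = z 0 := rfl
      have a1 : ((1 : Fin 4).insertNth 1 z : Fin 4 → ℝ) 1 = 1 := rfl
      have a2 : ((1 : Fin 4).insertNth 1 z : Fin 4 → ℝ) 2 = z 1 := rfl
      have a3 : ((1 : Fin 4).insertNth 1 z : Fin 4 → ℝ) 3 = z 2 := rfl
      have r0 : finRotate 3 0 = 1 := by decide
      have r1 : finRotate 3 1 = 2 := by decide
      have r2 : finRotate 3 2 = 0 := by decide
      simp only [g, a0, a1, a2, a3, r0, r1, r2]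
      rw [kd_comm d 1 (z 1)]
      ring
    have e2 : ∫⁻ z, (fun x : Fin 4 → ℝ => kd d (x 0 - x 1) * kd d (x 1 - x 2) * kd d (x 2 - x 3) * kd d (x 3 - x 0))
        ((2 : Fin 4).insertNth 1 z) ∂piI 3 = M3 d := by
      rw [hg, ← piI_perm g hgm (finRotate 3).symm]
      refine lintegral_congr fun z => ?_
      have a0 : ((2 : Fin 4).insertNth 1 z : Fin 4 → ℝ) 0 = z 0 := rfl
      have a1 : ((2 : Fin 4).insertNth 1 z : Fin 4 → ℝ) 1 = z 1 := rfl
      have a2 : ((2 : Fin 4).insertNth 1 z : Fin 4 → ℝ) 2 = 1 := rfl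
      have a3 : ((2 : Fin 4).insertNth 1 z : Fin 4 → ℝ) 3 = z 2 := rfl
      have r0 : (finRotate 3).symm 0 = 2 := by decide
      have r1 : (finRotate 3).symm 1 = 0 := by decide
      have r2 : (finRotate 3).symm 2 = 1 := by decide
      simp only [g, a0, a1, a2, a3, r0, r1, r2]
      rw [kd_comm d 1 (z 2)]
      ring
    rw [e0, e1, e2, e3]
    congr 1
    · congr 2; push_cast; ring
    · ring
  · intro t ht x
    simp only [Pi.smul_apply, smul_eq_mul, ← mul_sub, kd_mul d t _ ht, rpow4 d t ht]
    ring

lemma B_lint (d : ℝ) (h1 : d < 1/2) : ∫⁻ s, kd d s * kd d (s - 1) ∂muI =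
    ENNReal.ofReal (ProbabilityTheory.beta (1-d) (1-d)) := by
  rw [← beta_lint (by linarith) (by linarith)]
  apply lintegral_congr_ae
  filter_upwards [muI_ae] with s hs
  rw [kd_comm, kd, kd, ← ENNReal.ofReal_mul (by positivity), abs_of_pos hs.1, abs_of_pos (by linarith [hs.2])]
  congr 3 <;> ring

lemma J2_eq (d : ℝ) (h1 : d < 1/2) :
    J2 d = ENNReal.ofReal (ProbabilityTheory.beta (1-d) (1-d) ^ 2) := by
  unfold J2
  have hb := ProbabilityTheory.beta_pos (α := 1-d) (β := 1-d) (by linarith) (by linarith)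
  rw [piI_two _ (by fun_prop), ENNReal.ofReal_pow hb.le, ← B_lint d h1, sq, ← lintegral_mul_const _ (by fun_prop)]
  refine lintegral_congr fun t => ?_
  rw [← lintegral_const_mul _ (by fun_prop)]
  refine lintegral_congr fun s => ?_
  have a0 : (![t, s] : Fin 2 → ℝ) 0 = t := rfl
  have a1 : (![t, s] : Fin 2 → ℝ) 1 = s := rfl
  rw [a0, a1, kd_comm d 1 s]
  ring

noncomputable def KK (d : ℝ) : ℝ≥0∞ :=
  ∫⁻ t, ∫⁻ s, ENNReal.ofReal (t ^ (1-2*d)) * (kd d (s - 1) * kd d (t * s - 1)) ∂muI ∂muI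

lemma J1_eq (d : ℝ) (h1 : d < 1/2) :
    J1 d = KK d + ENNReal.ofReal (ProbabilityTheory.beta (1-d) (1-d) * ProbabilityTheory.beta (2-2*d) (1-d)) := by
  unfold J1
  have hp : ∀ t : ℝ, 0 < t → ENNReal.ofReal (t ^ (1-2*d)) =
      ENNReal.ofReal (t^1) * ENNReal.ofReal (t ^ (-d)) * ENNReal.ofReal (t ^ (-d)) := by
    intro t ht
    rw [← ENNReal.ofReal_mul (by positivity), ← ENNReal.ofReal_mul (by positivity), ← Real.rpow_natCast,
      ← Real.rpow_add ht, ← Real.rpow_add ht]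
    congr 2; push_cast; ring
  have hk : ∀ t : ℝ, 0 < t → kd d t = ENNReal.ofReal (t ^ (-d)) := by
    intro t ht; rw [kd, abs_of_pos ht]
  rw [max_split _ (by fun_prop), Fin.sum_univ_two]
  congr 1
  · unfold KK
    apply lintegral_congr_ae
    filter_upwards [muI_ae] with t ht
    rw [piI_one, ← lintegral_const_mul]
    · refine lintegral_congr fun s => ?_
      have a0 : ((0 : Fin 2).insertNth t (t • ![s]) : Fin 2 → ℝ) 0 = t := rfl
      have a1 : ((0 : Fin 2).insertNth t (t • ![s]) : Fin 2 → ℝ) 1 = t * s := rfl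
      rw [a0, a1, show t - t * s = t * (1 - s) by ring, kd_mul d t _ ht.1, hk t ht.1, hp t ht.1, kd_comm d 1 s]
      ring
    · have : Measurable fun s : ℝ => ((0 : Fin 2).insertNth t (t • ![s]) : Fin 2 → ℝ) :=
        (meas_insertNth _ _).comp (by fun_prop)
      fun_prop
    · have : Measurable fun s : Fin 1 → ℝ => ((0 : Fin 2).insertNth t (t • s) : Fin 2 → ℝ) :=
        (meas_insertNth _ _).comp (by fun_prop)
      fun_prop
  · have hb := ProbabilityTheory.beta_pos (α := 1-d) (β := 1-d) (by linarith) (by linarith)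
    rw [ENNReal.ofReal_mul hb.le, ← beta_lint (a := 2-2*d) (b := 1-d) (by linarith) (by linarith),
      ← lintegral_const_mul _ (by fun_prop)]
    apply lintegral_congr_ae
    filter_upwards [muI_ae] with t ht
    rw [piI_one, ← B_lint d h1, ← lintegral_const_mul, ← lintegral_mul_const]
    · refine lintegral_congr fun s => ?_
      have a0 : ((1 : Fin 2).insertNth t (t • ![s]) : Fin 2 → ℝ) 0 = t * s := rfl
      have a1 : ((1 : Fin 2).insertNth t (t • ![s]) : Fin 2 → ℝ) 1 = t := rfl
      rw [a0, a1, show t * s - t = t * (s - 1) by ring, kd_mul d t _ ht.1, kd_mul d t _ ht.1,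
        ENNReal.ofReal_mul (by have := ht.1; positivity), show (2 - 2*d - 1) = 1 - 2*d by ring, hp t ht.1,
        show 1 - d - 1 = -d by ring, kd_comm d t 1, hk (1-t) (by linarith [ht.2])]
      ring
    · fun_prop
    · have : Measurable fun s : ℝ => ((1 : Fin 2).insertNth t (t • ![s]) : Fin 2 → ℝ) :=
        (meas_insertNth _ _).comp (by fun_prop)
      fun_prop
    · have : Measurable fun s : Fin 1 → ℝ => ((1 : Fin 2).insertNth t (t • s) : Fin 2 → ℝ) :=
        (meas_insertNth _ _).comp (by fun_prop)
      fun_prop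

lemma KK_lt_top (d : ℝ) (h0 : 0 ≤ d) (h1 : d < 1/2) : KK d < ∞ := by
  have h : KK d ≤ ∫⁻ t, ENNReal.ofReal (t ^ (1-2*d)) * ∫⁻ s, ENNReal.ofReal (s ^ ((1:ℝ)-1) * (1 - s) ^ ((1-2*d) - 1)) ∂muI ∂muI := by
    unfold KK
    apply lintegral_mono_ae
    filter_upwards [muI_ae] with t ht
    rw [← lintegral_const_mul _ (by fun_prop)]
    apply lintegral_mono_ae
    filter_upwards [muI_ae] with s hs
    gcongr
    have hs1 : 0 < 1 - s := by linarith [hs.2]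
    have hle : 1 - s ≤ 1 - t * s := by nlinarith [hs.1, ht.2]
    have hts : 0 < 1 - t * s := by linarith
    rw [kd_comm, kd_comm d (t*s), kd, kd, ← ENNReal.ofReal_mul (by positivity), abs_of_pos hs1, abs_of_pos hts]
    apply ENNReal.ofReal_le_ofReal
    rw [sub_self, Real.rpow_zero, one_mul, show 1 - 2*d - 1 = -d + -d by ring, Real.rpow_add hs1]
    gcongr ?_ * ?_
    exact Real.rpow_le_rpow_of_nonpos hs1 hle (by linarith)
  refine h.trans_lt ?_
  rw [lintegral_mul_const _ (by fun_prop), pow_lint (by linarith), beta_lint one_pos (by linarith)]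
  exact ENNReal.mul_lt_top ENNReal.ofReal_lt_top ENNReal.ofReal_lt_top

end helpers2

section helpers3
open MeasureTheory Set
open scoped ENNReal

lemma poch_succ (a : ℝ) (n : ℕ) : poch a (n+1) = poch a n * (a + n) := by
  simp [poch, Finset.prod_range_succ]

lemma poch_zero (a : ℝ) : poch a 0 = 1 := by simp [poch]

lemma poch_pos (a : ℝ) (ha : 0 < a) (n : ℕ) : 0 < poch a n := by
  unfold poch; exact Finset.prod_pos fun i _ => by positivity

lemma poch_nonneg (a : ℝ) (ha : 0 ≤ a) (n : ℕ) : 0 ≤ poch a n := by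
  unfold poch; exact Finset.prod_nonneg fun i _ => by positivity

lemma poch_asc (a : ℝ) (n : ℕ) : (ascPochhammer ℝ n).eval a = poch a n := by
  induction n with
  | zero => simp [poch_zero]
  | succ n ih => rw [ascPochhammer_succ_eval, ih, poch_succ]

lemma choose_poch (d : ℝ) (n : ℕ) : Ring.choose (d + n - 1) n = poch d n / (Nat.factorial n : ℝ) := by
  have h := Ring.factorial_nsmul_multichoose_eq_ascPochhammer d n
  rw [Polynomial.ascPochhammer_smeval_eq_eval, poch_asc, nsmul_eq_mul] at h
  have h2 : Ring.choose (d + n - 1) n = Ring.multichoose d n := by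
    rw [Ring.choose]; congr 1; ring
  rw [h2, ← h]
  field_simp

lemma binom_hasSum (d x : ℝ) (hx0 : 0 ≤ x) (hx1 : x < 1) :
    HasSum (fun n : ℕ => poch d n / (Nat.factorial n : ℝ) * x ^ n) ((1 - x) ^ (-d)) := by
  have h := (Real.one_div_one_sub_rpow_hasFPowerSeriesOnBall_zero d).hasSum (y := x)
    (by simp [enorm_eq_nnnorm, ← NNReal.coe_lt_coe, abs_of_nonneg hx0, hx1])
  simp only [zero_add, FormalMultilinearSeries.ofScalars_apply_eq, choose_poch, smul_eq_mul] at h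
  rw [Real.rpow_neg (by linarith), ← one_div]
  exact h

lemma Gamma_poch (a : ℝ) (ha : 0 < a) (n : ℕ) : Real.Gamma (a + n) = poch a n * Real.Gamma a := by
  induction n with
  | zero => simp [poch_zero]
  | succ n ih =>
    push_cast
    rw [← add_assoc, Real.Gamma_add_one (by positivity), ih, poch_succ]; ring

lemma poch_one (n : ℕ) : poch 1 n = (Nat.factorial n : ℝ) := by
  induction n with
  | zero => simp [poch_zero]
  | succ n ih => rw [poch_succ, ih, Nat.factorial_succ]; push_cast; ring

lemma poch_shift (a : ℝ) (n : ℕ) : poch a n * (a + n) = a * poch (a+1) n := by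
  induction n with
  | zero => simp [poch_zero]
  | succ n ih =>
    rw [poch_succ, poch_succ, ih]; push_cast; ring

noncomputable def trm (d : ℝ) (k : ℕ) : ℝ :=
  poch 1 k * poch d k * poch (2-2*d) k / (poch (2-d) k * poch (3-2*d) k * (Nat.factorial k : ℝ))

lemma trm_eq (d : ℝ) (h1 : d < 1/2) (n : ℕ) :
    poch d n / (Nat.factorial n : ℝ) * (1 / (n + 2 - 2*d)) * ProbabilityTheory.beta (n+1) (1-d) =
    trm d n / (2 * (1-d)^2) := by
  have hs := poch_shift (2-2*d) n
  rw [show 2 - 2*d + 1 = 3 - 2*d by ring] at hs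
  have p1 := poch_pos (2-d) (by linarith) n
  have p2 := poch_pos (3-2*d) (by linarith) n
  have p3 := poch_pos (2-2*d) (by linarith) n
  have hG : Real.Gamma ((n:ℝ) + 1 + (1 - d)) = poch (2-d) n * ((1-d) * Real.Gamma (1-d)) := by
    rw [show (n:ℝ) + 1 + (1-d) = (2-d) + n by ring, Gamma_poch _ (by linarith),
      show 2 - d = (1 - d) + 1 by ring, Real.Gamma_add_one (by linarith)]
  have hg : 0 < Real.Gamma (1-d) := Real.Gamma_pos_of_pos (by linarith)
  have hd : 0 < 1 - d := by linarith
  have hn : 0 < (n:ℝ) + 2 - 2*d := by have : (0:ℝ) ≤ n := by positivity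
                                      linarith
  have hf : (0:ℝ) < (Nat.factorial n : ℝ) := by positivity
  have h3 : poch (3-2*d) n = poch (2-2*d) n * (n + 2 - 2*d) / (2 * (1-d)) := by
    rw [eq_div_iff (by positivity)]; linarith
  rw [trm, poch_one, h3, ProbabilityTheory.beta, Real.Gamma_nat_eq_factorial, hG]
  clear h3 hs p2 hG
  generalize poch (2-2*d) n = P at *
  generalize poch (2-d) n = Q at *
  field_simp

lemma KK_eq (d : ℝ) (h0 : 0 ≤ d) (h1 : d < 1/2) :
    KK d = ∑' n : ℕ, ENNReal.ofReal (trm d n / (2 * (1-d)^2)) := by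
  have hc : ∀ n, 0 ≤ poch d n / (Nat.factorial n : ℝ) := fun n =>
    div_nonneg (poch_nonneg d h0 n) (by positivity)
  have e1 : KK d = ∫⁻ t, ∫⁻ s, ∑' n : ℕ, ENNReal.ofReal (poch d n / (Nat.factorial n : ℝ)) *
      (ENNReal.ofReal (t ^ ((n:ℝ) + 1 - 2*d)) *
        ENNReal.ofReal (s ^ ((n:ℝ) + 1 - 1) * (1 - s) ^ ((1-d) - 1))) ∂muI ∂muI := by
    unfold KK
    apply lintegral_congr_ae
    filter_upwards [muI_ae] with t ht
    apply lintegral_congr_ae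
    filter_upwards [muI_ae] with s hs
    obtain ⟨ht0, ht1⟩ := ht
    obtain ⟨hs0, hs1⟩ := hs
    have hts : t * s < 1 := by nlinarith
    have hb := binom_hasSum d (t*s) (by positivity) hts
    have hk : kd d (t * s - 1) = ∑' n : ℕ, ENNReal.ofReal (poch d n / (Nat.factorial n : ℝ) * (t*s)^n) := by
      rw [kd_comm, kd, abs_of_pos (by linarith), ← hb.tsum_eq]
      exact ENNReal.ofReal_tsum_of_nonneg (fun n => mul_nonneg (hc n) (by positivity)) hb.summable
    rw [hk, ← ENNReal.tsum_mul_left, ← ENNReal.tsum_mul_left]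
    refine tsum_congr fun n => ?_
    have h2 : 0 < 1 - s := by linarith
    rw [kd_comm, kd, abs_of_pos h2, ← ENNReal.ofReal_mul (by positivity), ← ENNReal.ofReal_mul (by positivity),
      ← ENNReal.ofReal_mul (by positivity), ← ENNReal.ofReal_mul (hc n)]
    congr 1
    rw [show (n:ℝ) + 1 - 2*d = n + (1 - 2*d) by ring, Real.rpow_add ht0, Real.rpow_natCast,
      show (n:ℝ) + 1 - 1 = n by ring, Real.rpow_natCast, show 1 - d - 1 = -d by ring, mul_pow]
    ring
  rw [e1]
  have e2 : ∀ t : ℝ, ∫⁻ s, ∑' n : ℕ, ENNReal.ofReal (poch d n / (Nat.factorial n : ℝ)) *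
      (ENNReal.ofReal (t ^ ((n:ℝ) + 1 - 2*d)) *
        ENNReal.ofReal (s ^ ((n:ℝ) + 1 - 1) * (1 - s) ^ ((1-d) - 1))) ∂muI =
      ∑' n : ℕ, ENNReal.ofReal (poch d n / (Nat.factorial n : ℝ)) *
      (ENNReal.ofReal (t ^ ((n:ℝ) + 1 - 2*d)) * ENNReal.ofReal (ProbabilityTheory.beta (n+1) (1-d))) := by
    intro t
    rw [lintegral_tsum (fun n => by fun_prop)]
    refine tsum_congr fun n => ?_
    rw [lintegral_const_mul _ (by fun_prop), lintegral_const_mul _ (by fun_prop),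
      beta_lint (by positivity) (by linarith)]
  simp_rw [e2]
  rw [lintegral_tsum (fun n => by fun_prop)]
  refine tsum_congr fun n => ?_
  have hn : (0:ℝ) ≤ n := by positivity
  rw [lintegral_const_mul _ (by fun_prop), lintegral_mul_const _ (by fun_prop), pow_lint (by linarith),
    ← trm_eq d h1, mul_assoc, ENNReal.ofReal_mul (hc n), ENNReal.ofReal_mul (by
      apply div_nonneg zero_le_one; linarith)]
  congr 4
  ring

lemma KK_toReal (d : ℝ) (h0 : 0 ≤ d) (h1 : d < 1/2) :
    (KK d).toReal = F32 1 d (2-2*d) (2-d) (3-2*d) / (2 * (1-d)^2) := by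
  rw [KK_eq d h0 h1, ENNReal.tsum_toReal_eq (fun _ => ENNReal.ofReal_ne_top), F32, ← tsum_div_const]
  refine tsum_congr fun n => ?_
  rw [ENNReal.toReal_ofReal]
  · rfl
  · unfold trm
    have := poch_nonneg d h0 n
    have p1 := poch_pos (2-d) (by linarith) n
    have p2 := poch_pos (3-2*d) (by linarith) n
    have p3 := poch_pos (2-2*d) (by linarith) n
    have p4 := poch_pos 1 (by linarith) n
    positivity

lemma J1_lt_top (d : ℝ) (h0 : 0 ≤ d) (h1 : d < 1/2) : J1 d < ∞ := by
  rw [J1_eq d h1]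
  exact ENNReal.add_lt_top.2 ⟨KK_lt_top d h0 h1, ENNReal.ofReal_lt_top⟩

lemma I4_lt_top (d : ℝ) (h0 : 0 ≤ d) (h1 : d < 1/2) : I4 d < ∞ := by
  rw [I4_eq d h1, M3_eq d h1, J2_eq d h1]
  have := (J1_lt_top d h0 h1).ne
  rw [lt_top_iff_ne_top]
  refine ENNReal.mul_ne_top ENNReal.ofReal_ne_top (ENNReal.mul_ne_top (by simp)
    (ENNReal.mul_ne_top ENNReal.ofReal_ne_top (ENNReal.add_ne_top.2
      ⟨ENNReal.mul_ne_top (by simp) this, ENNReal.ofReal_ne_top⟩)))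

lemma c4_eq (d : ℝ) (h0 : 0 ≤ d) (h1 : d < 1/2) : c4 d = (I4 d).toReal := by
  have hfin := I4_lt_top d h0 h1
  have h4 := piI_four (fun x => kd d (x 0 - x 1) * kd d (x 1 - x 2) * kd d (x 2 - x 3) * kd d (x 3 - x 0))
    (by fun_prop)
  change I4 d = ∫⁻ a, ∫⁻ b, ∫⁻ t, ∫⁻ s, kd d (a - b) * kd d (b - t) * kd d (t - s) * kd d (s - a)
    ∂muI ∂muI ∂muI ∂muI at h4
  rw [h4] at hfin ⊢
  unfold c4
  refine nest_step (by fun_prop) hfin fun a ha => ?_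
  refine nest_step (by fun_prop) ha fun b hb => ?_
  refine nest_step (by fun_prop) hb fun t ht => ?_
  refine nest_step (by fun_prop) ht fun s _ => ?_
  simp only [kd, ENNReal.toReal_mul]
  rw [ENNReal.toReal_ofReal (by positivity), ENNReal.toReal_ofReal (by positivity),
    ENNReal.toReal_ofReal (by positivity), ENNReal.toReal_ofReal (by positivity)]

lemma c4_val (d : ℝ) (h0 : 0 ≤ d) (h1 : d < 1/2) :
    c4 d = 1 / (4 - 4*d) * (4 * (1 / (3 - 4*d) * (2 *
      (F32 1 d (2-2*d) (2-d) (3-2*d) / (2 * (1-d)^2) +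
        ProbabilityTheory.beta (1-d) (1-d) * ProbabilityTheory.beta (2-2*d) (1-d)) +
      ProbabilityTheory.beta (1-d) (1-d) ^ 2))) := by
  have hb := ProbabilityTheory.beta_pos (α := 1-d) (β := 1-d) (by linarith) (by linarith)
  have hb2 := ProbabilityTheory.beta_pos (α := 2-2*d) (β := 1-d) (by linarith) (by linarith)
  have q1 : 0 ≤ 1 / (4 - 4*d) := by apply div_nonneg zero_le_one; linarith
  have q2 : 0 ≤ 1 / (3 - 4*d) := by apply div_nonneg zero_le_one; linarith
  rw [c4_eq d h0 h1, I4_eq d h1, M3_eq d h1, ENNReal.toReal_mul, ENNReal.toReal_mul, ENNReal.toReal_mul,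
    ENNReal.toReal_add, ENNReal.toReal_mul, J2_eq d h1, J1_eq d h1, ENNReal.toReal_add (KK_lt_top d h0 h1).ne
    ENNReal.ofReal_ne_top, KK_toReal d h0 h1, ENNReal.toReal_ofReal q1, ENNReal.toReal_ofReal q2,
    ENNReal.toReal_ofReal (by positivity), ENNReal.toReal_ofReal (by positivity)]
  · simp
  · exact ENNReal.mul_ne_top (by simp) (J1_lt_top d h0 h1).ne
  · rw [J2_eq d h1]; exact ENNReal.ofReal_ne_top

end helpers3

theorem rosenblatt_fourth_cumulant (d : ℝ) (h0 : 0 ≤ d) (h1 : d < 1/2) :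
    2 ^ 3 * (Nat.factorial 3 : ℝ) * ((1/2) * (1 - 2*d) * (1 - d)) ^ 2 * c4 d =
      12 * (1 - 2*d) ^ 2 / ((1 - d) * (3 - 4*d)) *
        (2 * Gamma (1-d) * Gamma (2-d) ^ 2 / Gamma (3-3*d) +
         Gamma (1-d) ^ 2 * Gamma (2-d) ^ 2 / Gamma (2-2*d) ^ 2 +
         F32 1 d (2-2*d) (2-d) (3-2*d)) := by
  have hf : (Nat.factorial 3 : ℝ) = 6 := by norm_num [Nat.factorial]
  have hG : Gamma (2-d) = (1-d) * Gamma (1-d) := by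
    rw [show 2 - d = (1-d) + 1 by ring, Real.Gamma_add_one (by linarith)]
  rw [c4_val d h0 h1, hf, hG, ProbabilityTheory.beta, ProbabilityTheory.beta,
    show 1 - d + (1 - d) = 2 - 2*d by ring, show 2 - 2*d + (1 - d) = 3 - 3*d by ring,
    show 4 - 4*d = 4 * (1-d) by ring]
  have g1 : Gamma (2-2*d) ≠ 0 := (Real.Gamma_pos_of_pos (by linarith)).ne'
  have g2 : Gamma (3-3*d) ≠ 0 := (Real.Gamma_pos_of_pos (by linarith)).ne'
  have n1 : 1 - d ≠ 0 := by linarith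
  have n2 : 3 - 4*d ≠ 0 := by linarith
  generalize F32 1 d (2-2*d) (2-d) (3-2*d) = F
  generalize Gamma (2-2*d) = A at *
  generalize Gamma (3-3*d) = B at *
  generalize Gamma (1-d) = C at *
  field_simp
  ring
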